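/- arXiv:1204.5660 — 2 statements merged into one kernel-verified Lean document; each statement's English description precedes it below -/
import Mathlib

section
/- Let N > 0 and let (ρ_k) be a sequence of nonnegative functions in L¹(ℝ³) with ∫ρ_k = N for all k. Then there exists a subsequence (still denoted ρ_k) such that one of the following holds. (i) Vanishing: for all R > 0, lim_{k→∞} sup_{y∈ℝ³} ∫_{B(y,R)} ρ_k = 0. (ii) There exists λ ∈ (0,N] such that for every ε > 0 there exist R_ε > 0, a sequence of points y_k = y_k(ε) in ℝ³, and a sequence of reals P_k = P_k(ε) with P_k → ∞ as k → ∞, such that the functions ρ_{k,1} := ρ_k·χ_{B(y_k,R_ε)} and ρ_{k,2} := ρ_k·χ_{B(y_k,P_k)ᶜ} satisfy, for all k large enough: ‖ρ_k − ρ_{k,1} − ρ_{k,2}‖_{L¹} ≤ ε, |∫ρ_{k,1} − λ| ≤ ε, |∫ρ_{k,2} − (N−λ)| ≤ ε, and dist(supp ρ_{k,1}, supp ρ_{k,2}) → ∞ as k → ∞. -/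
open MeasureTheory Metric Filter

/-- The concentration function `r ↦ sup_y ∫_{B(y,r)} f`. -/
noncomputable def concFun (f : EuclideanSpace ℝ (Fin 3) → ℝ) (r : ℝ) : ℝ :=
  ⨆ y : EuclideanSpace ℝ (Fin 3), ∫ x in ball y r, f x

theorem exists_subseq_tendsto_forall_of_mem_Icc {ι : Type*} [Countable ι] {a b : ℝ}
    (u : ℕ → ι → ℝ) (hu : ∀ k n, u k n ∈ Set.Icc a b) :
    ∃ φ : ℕ → ℕ, StrictMono φ ∧ ∃ Q : ι → ℝ, ∀ n,
      Q n ∈ Set.Icc a b ∧ Tendsto (fun k => u (φ k) n) atTop (nhds (Q n)) := by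
  have hc : IsCompact (Set.univ.pi fun _ : ι => Set.Icc a b) :=
    isCompact_univ_pi fun _ => isCompact_Icc
  obtain ⟨Q, hQ, φ, hφ, hlim⟩ := hc.tendsto_subseq (x := u) fun k n _ => hu k n
  exact ⟨φ, hφ, Q, fun n => ⟨hQ n trivial, (tendsto_pi_nhds.1 hlim) n⟩⟩

section ConcFun

variable {f : EuclideanSpace ℝ (Fin 3) → ℝ}

theorem setIntegral_ball_mono (hf : Integrable f) (h0 : ∀ x, 0 ≤ f x)
    (y : EuclideanSpace ℝ (Fin 3)) {r s : ℝ} (h : r ≤ s) :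
    ∫ x in ball y r, f x ≤ ∫ x in ball y s, f x :=
  setIntegral_mono_set hf.integrableOn (ae_of_all _ h0) (ball_subset_ball h).eventuallyLE

theorem bddAbove_setIntegral_ball (hf : Integrable f) (h0 : ∀ x, 0 ≤ f x) (r : ℝ) :
    BddAbove (Set.range fun y : EuclideanSpace ℝ (Fin 3) => ∫ x in ball y r, f x) :=
  ⟨∫ x, f x, by
    rintro _ ⟨y, rfl⟩
    exact setIntegral_le_integral hf (ae_of_all _ h0)⟩

theorem setIntegral_ball_le_concFun (hf : Integrable f) (h0 : ∀ x, 0 ≤ f x)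
    (y : EuclideanSpace ℝ (Fin 3)) (r : ℝ) :
    ∫ x in ball y r, f x ≤ concFun f r :=
  le_ciSup (bddAbove_setIntegral_ball hf h0 r) y

theorem concFun_nonneg (h0 : ∀ x, 0 ≤ f x) (r : ℝ) : 0 ≤ concFun f r :=
  Real.iSup_nonneg fun _ => integral_nonneg h0

theorem concFun_le_integral (hf : Integrable f) (h0 : ∀ x, 0 ≤ f x) (r : ℝ) :
    concFun f r ≤ ∫ x, f x :=
  ciSup_le fun _ => setIntegral_le_integral hf (ae_of_all _ h0)

theorem concFun_mono (hf : Integrable f) (h0 : ∀ x, 0 ≤ f x) : Monotone (concFun f) :=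
  fun _ s h => ciSup_mono (bddAbove_setIntegral_ball hf h0 s)
    fun y => setIntegral_ball_mono hf h0 y h

theorem concFun_zero (f : EuclideanSpace ℝ (Fin 3) → ℝ) : concFun f 0 = 0 := by
  simp [concFun]

/-- The mass of the complement of a ball. -/
theorem integral_indicator_compl_ball (hf : Integrable f) (y : EuclideanSpace ℝ (Fin 3)) (r : ℝ) :
    ∫ x, (ball y r)ᶜ.indicator f x = (∫ x, f x) - ∫ x in ball y r, f x := by
  rw [integral_indicator measurableSet_ball.compl, ← integral_add_compl measurableSet_ball hf]
  ring

/-- The mass of an annulus. -/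
theorem integral_abs_sub_indicator_ball (hf : Integrable f) (h0 : ∀ x, 0 ≤ f x)
    (y : EuclideanSpace ℝ (Fin 3)) {r s : ℝ} (h : r ≤ s) :
    ∫ x, |f x - (ball y r).indicator f x - (ball y s)ᶜ.indicator f x| =
      (∫ x in ball y s, f x) - ∫ x in ball y r, f x := by
  have habs : ∀ x, |f x - (ball y r).indicator f x - (ball y s)ᶜ.indicator f x| =
      f x - (ball y r).indicator f x - (ball y s)ᶜ.indicator f x := by
    intro x
    refine abs_of_nonneg ?_
    by_cases hr : x ∈ ball y r
    · have hs : x ∈ ball y s := ball_subset_ball h hr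
      simp [hr, hs, -mem_ball]
    · by_cases hs : x ∈ ball y s <;> simp [hr, hs, h0 x, -mem_ball]
  have hir := hf.indicator (measurableSet_ball (x := y) (ε := r))
  have his := hf.indicator (measurableSet_ball (x := y) (ε := s)).compl
  simp_rw [habs]
  rw [integral_sub (f := fun x => f x - (ball y r).indicator f x) (hf.sub hir) his,
    integral_sub hf hir, integral_indicator_compl_ball hf,
    integral_indicator measurableSet_ball]
  ring

end ConcFun

/-- If each column of `u` is eventually at most `c`, then so is `u` along a diagonal that goes
to infinity. -/
theorem exists_tendsto_atTop_forall_le {u : ℕ → ℕ → ℝ} {c : ℝ}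
    (h0 : ∀ k, u k 0 ≤ c) (hu : ∀ n, ∀ᶠ k in atTop, u k n ≤ c) :
    ∃ p : ℕ → ℕ, Tendsto p atTop atTop ∧ ∀ k, u k (p k) ≤ c := by
  classical
  refine ⟨fun k => Nat.findGreatest (fun n => u k n ≤ c) k, tendsto_atTop.2 fun m => ?_,
    fun k => Nat.findGreatest_spec (P := fun n => u k n ≤ c) (Nat.zero_le k) (h0 k)⟩
  filter_upwards [hu m, eventually_ge_atTop m] with k hk hmk
  exact Nat.le_findGreatest hmk hk

/-- **Concentration compactness (Proposition 2.2, parts (i)/(ii)).**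
For a sequence of nonnegative `L¹` functions on `ℝ³` of constant mass `N > 0`, there is a
subsequence that either vanishes, or exhibits dichotomy/compactness with parameter
`λ ∈ (0, N]`. -/
theorem concentration_compactness
    (N : ℝ) (hN : 0 < N)
    (ρ : ℕ → EuclideanSpace ℝ (Fin 3) → ℝ)
    (hint : ∀ k, Integrable (ρ k))
    (hpos : ∀ k x, 0 ≤ ρ k x)
    (hmass : ∀ k, (∫ x, ρ k x) = N) :
    ∃ φ : ℕ → ℕ, StrictMono φ ∧
      ((∀ R > (0:ℝ),
          Tendsto (fun k => ⨆ y : EuclideanSpace ℝ (Fin 3), ∫ x in ball y R, ρ (φ k) x)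
            atTop (nhds 0))
       ∨
       (∃ lam : ℝ, lam ∈ Set.Ioc 0 N ∧
          ∀ ε > (0:ℝ), ∃ Rε > (0:ℝ), ∃ y : ℕ → EuclideanSpace ℝ (Fin 3), ∃ P : ℕ → ℝ,
            Tendsto P atTop atTop ∧
            (∀ᶠ k in atTop,
              (∫ x, |ρ (φ k) x - (ball (y k) Rε).indicator (ρ (φ k)) x
                  - ((ball (y k) (P k))ᶜ).indicator (ρ (φ k)) x|) ≤ ε ∧
              |(∫ x, (ball (y k) Rε).indicator (ρ (φ k)) x) - lam| ≤ ε ∧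
              |(∫ x, ((ball (y k) (P k))ᶜ).indicator (ρ (φ k)) x) - (N - lam)| ≤ ε) ∧
            (∀ M : ℝ, ∀ᶠ k in atTop,
              ∀ a ∈ Function.support ((ball (y k) Rε).indicator (ρ (φ k))),
              ∀ b ∈ Function.support (((ball (y k) (P k))ᶜ).indicator (ρ (φ k))),
                M ≤ dist a b))) := by
  obtain ⟨φ, hφ, Q, hQ⟩ := exists_subseq_tendsto_forall_of_mem_Icc (a := 0) (b := N)
    (fun k n => concFun (ρ k) (n : ℕ)) fun k n =>
      ⟨concFun_nonneg (hpos k) _, (concFun_le_integral (hint k) (hpos k) _).trans_eq (hmass k)⟩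
  have hbdd : BddAbove (Set.range Q) := ⟨N, by rintro _ ⟨n, rfl⟩; exact (hQ n).1.2⟩
  have hle : ∀ n, Q n ≤ ⨆ n, Q n := le_ciSup hbdd
  have hmono : Monotone Q := fun m n hmn =>
    le_of_tendsto_of_tendsto' (hQ m).2 (hQ n).2 fun k =>
      concFun_mono (hint _) (hpos _) (Nat.cast_le.2 hmn)
  refine ⟨φ, hφ, ?_⟩
  rcases ((hQ 0).1.1.trans (hle 0)).eq_or_lt with h0 | hlam
  · left
    intro R _
    obtain ⟨n, hn⟩ := exists_nat_ge R
    have hQn : Q n = 0 := le_antisymm (h0 ▸ hle n) (hQ n).1.1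
    exact squeeze_zero (fun k => concFun_nonneg (hpos (φ k)) R)
      (fun k => concFun_mono (hint _) (hpos _) hn) (hQn ▸ (hQ n).2)
  right
  refine ⟨⨆ n, Q n, ⟨hlam, ciSup_le fun n => (hQ n).1.2⟩, fun ε hε => ?_⟩
  set lam := ⨆ n, Q n
  obtain ⟨m, hm⟩ : ∃ m, lam - ε / 3 < Q m := exists_lt_of_lt_ciSup (by linarith)
  obtain ⟨n, hn1, hn⟩ : ∃ n : ℕ, 1 ≤ n ∧ lam - ε / 3 < Q n :=
    ⟨max m 1, le_max_right _ _, hm.trans_le (hmono (le_max_left _ _))⟩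
  have hy : ∀ k, ∃ y : EuclideanSpace ℝ (Fin 3),
      concFun (ρ (φ k)) n - ε / 3 < ∫ x in ball y n, ρ (φ k) x := fun k =>
    exists_lt_of_lt_ciSup (sub_lt_self (concFun (ρ (φ k)) n) (by positivity))
  choose y hy using hy
  obtain ⟨p, hp, hpc⟩ := exists_tendsto_atTop_forall_le
    (u := fun k n => concFun (ρ (φ k)) (n : ℕ)) (c := lam + ε / 3)
    (fun k => by simpa [concFun_zero] using by positivity)
    (fun n => ((hQ n).2.eventually_lt_const (by linarith [hle n])).mono fun _ => le_of_lt)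
  refine ⟨n, by exact_mod_cast hn1, y, fun k => p k,
    tendsto_natCast_atTop_atTop.comp hp, ?_, fun M => ?_⟩
  · filter_upwards [(hQ n).2.eventually_const_lt hn, hp.eventually_ge_atTop n] with k hk hnk
    have hnp : (n : ℝ) ≤ p k := Nat.cast_le.2 hnk
    have hin := setIntegral_ball_mono (hint (φ k)) (hpos (φ k)) (y k) hnp
    have hout := (setIntegral_ball_le_concFun (hint (φ k)) (hpos (φ k)) (y k) (p k)).trans (hpc k)
    have hyk := hy k
    rw [integral_abs_sub_indicator_ball (hint _) (hpos _) _ hnp,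
      integral_indicator measurableSet_ball, integral_indicator_compl_ball (hint _), hmass]
    refine ⟨by linarith, abs_le.2 ⟨by linarith, by linarith⟩, abs_le.2 ⟨by linarith, by linarith⟩⟩
  · filter_upwards [(tendsto_natCast_atTop_atTop (R := ℝ).comp hp).eventually_ge_atTop (M + n)]
      with k hk a ha b hb
    have ha' : dist a (y k) < n := (Set.support_indicator_subset ha : a ∈ ball (y k) n)
    have hb' : (p k : ℝ) ≤ dist b (y k) :=
      not_lt.1 (Set.support_indicator_subset hb : b ∈ (ball (y k) (p k))ᶜ)
    have := dist_triangle_left b (y k) a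
    simp only [Function.comp_apply] at hk
    linarith
end

section
/- Let N > 0, let (ρ_k) be a sequence of nonnegative functions in L¹(ℝ³) with ∫ρ_k = N for all k, and let λ ∈ (0,N]. Suppose that for every ε > 0 there exist a radius R_ε > 0 and points y_k(ε) ∈ ℝ³ (k ∈ ℕ) such that liminf_{k→∞} ∫_{B(y_k(ε),R_ε)} ρ_k ≥ λ − ε. Let m be a positive integer with mλ > N. Then there exist a subsequence (k_l), positive reals ε_1,…,ε_{m−1} and δ > 0 such that for all sufficiently small ε > 0: liminf_{l→∞} ∫_{B(y_{k_l}(ε),R_ε) ∩ (∪_{j=1}^{m−1} B(y_{k_l}(ε_j),R_{ε_j}))} ρ_{k_l} ≥ δ. -/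
open MeasureTheory Metric Filter

/-- Inclusion-exclusion for the integral over a union of two sets. -/
theorem setIntegral_union_add_inter {α : Type*} [MeasurableSpace α] {μ : Measure α} {f : α → ℝ}
    (hf : Integrable f μ) {s t : Set α} (ht : MeasurableSet t) :
    (∫ x in s ∪ t, f x ∂μ) + ∫ x in s ∩ t, f x ∂μ
      = (∫ x in s, f x ∂μ) + ∫ x in t, f x ∂μ := by
  have h₁ := integral_inter_add_sdiff (s := s) ht hf.integrableOn
  have h₂ := setIntegral_union (f := f) (μ := μ) (Set.disjoint_sdiff_left (s := t) (t := s)) ht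
    hf.integrableOn hf.integrableOn
  rw [Set.sdiff_union_self] at h₂
  linarith

/-- If the sets `A ε k` asymptotically carry mass at least `c - ε`, and along every subsequence
some `A ε k` with `ε < d` overlaps little with the union of any `p` others, then for `n ≤ p + 1`
some union of `n` of these sets carries mass at least `n * (c - 3 * d)` along a subsequence. -/
theorem exists_subseq_mul_le_setIntegral_iUnion {α : Type*} [MeasurableSpace α] {μ : Measure α}
    {f : ℕ → α → ℝ} (hint : ∀ k, Integrable (f k) μ) (hpos : ∀ k x, 0 ≤ f k x)
    {N c d : ℝ} (hmass : ∀ k, (∫ x, f k x ∂μ) = N)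
    {A : ℝ → ℕ → Set α} (hA : ∀ ε k, MeasurableSet (A ε k))
    (hconc : ∀ ε > (0 : ℝ), c - ε ≤ liminf (fun k => ∫ x in A ε k, f k x ∂μ) atTop) {p : ℕ}
    (hsep : ∀ φ : ℕ → ℕ, StrictMono φ → ∀ e : ℕ → ℝ, (∀ j, 0 < e j) →
      ∃ ε, 0 < ε ∧ ε < d ∧
        liminf (fun l => ∫ x in A ε (φ l) ∩ ⋃ j < p, A (e j) (φ l), f (φ l) x ∂μ) atTop < d)
    (n : ℕ) (hn : n ≤ p + 1) :
    ∃ φ : ℕ → ℕ, StrictMono φ ∧ ∃ e : ℕ → ℝ, (∀ j, 0 < e j) ∧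
      ∀ l, n * (c - 3 * d) ≤ ∫ x in ⋃ j < n, A (e j) (φ l), f (φ l) x ∂μ := by
  have hnonneg (k : ℕ) (s : Set α) : 0 ≤ ∫ x in s, f k x ∂μ :=
    integral_nonneg fun x => hpos k x
  have hle (k : ℕ) (s : Set α) : ∫ x in s, f k x ∂μ ≤ N :=
    hmass k ▸ setIntegral_le_integral (hint k) (ae_of_all _ (hpos k))
  have hmono (k : ℕ) {s t : Set α} (h : s ⊆ t) : ∫ x in s, f k x ∂μ ≤ ∫ x in t, f k x ∂μ :=
    setIntegral_mono_set (hint k).integrableOn (ae_of_all _ (hpos k)) h.eventuallyLE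
  induction n with
  | zero => exact ⟨id, strictMono_id, fun _ => 1, fun _ => one_pos, by simp⟩
  | succ n ih =>
    obtain ⟨φ, hφ, e, he, hU⟩ := ih (by omega)
    obtain ⟨ε, hε, hεd, hlim⟩ := hsep φ hφ e he
    have hfreq : ∃ᶠ l in atTop,
        ∫ x in A ε (φ l) ∩ ⋃ j < p, A (e j) (φ l), f (φ l) x ∂μ < d :=
      frequently_lt_of_liminf_lt
        (isBoundedUnder_of ⟨N, fun l => hle _ _⟩).isCoboundedUnder_ge hlim
    have hev : ∀ᶠ k in atTop, c - 2 * d < ∫ x in A ε k, f k x ∂μ :=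
      eventually_lt_of_lt_liminf (lt_of_lt_of_le (by linarith) (hconc ε hε))
        (isBoundedUnder_of ⟨0, fun l => hnonneg _ _⟩)
    obtain ⟨ψ, hψ, hψ'⟩ :=
      extraction_of_frequently_atTop (hfreq.and_eventually (hφ.tendsto_atTop.eventually hev))
    refine ⟨φ ∘ ψ, hφ.comp hψ, Function.update e n ε, fun j => ?_, fun l => ?_⟩
    · rcases eq_or_ne j n with rfl | h
      · simpa using hε
      · simpa [h] using he j
    · obtain ⟨h₁, h₂⟩ := hψ' l
      have h₃ := hU (ψ l)
      set k := φ (ψ l) with hk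
      have hunion : ⋃ j < n + 1, A (Function.update e n ε j) k
          = A ε k ∪ ⋃ j < n, A (e j) k := by
        rw [Set.biUnion_lt_succ, Set.union_comm, Function.update_self]
        congr 1
        exact Set.iUnion₂_congr fun j hj => by rw [Function.update_of_ne hj.ne]
      have hsub : A ε k ∩ ⋃ j < n, A (e j) k ⊆ A ε k ∩ ⋃ j < p, A (e j) k :=
        Set.inter_subset_inter_right _
          (Set.biUnion_subset_biUnion_left fun j (hj : j < n) =>
            show j < p by omega)
      have h₄ := hmono k hsub
      have h₅ := setIntegral_union_add_inter (hint k) (s := A ε k)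
        (MeasurableSet.iUnion fun j => MeasurableSet.iUnion fun (_ : j < n) => hA (e j) k)
      simp only [Function.comp_apply, ← hk, hunion]
      push_cast
      linarith

/-- **Overlap of concentration balls (last part of Proposition 2.2 (ii)).**
If for every `ε > 0` the mass of `ρ_k` in the ball `B(y_k(ε), R_ε)` is asymptotically at least
`λ - ε`, and `m λ > N`, then along a subsequence one can find levels `ε_1, …, ε_{m-1}` and
`δ > 0` such that for all small `ε > 0` a mass at least `δ` of `ρ_k` lies in
`B(y_k(ε), R_ε) ∩ ⋃_j B(y_k(ε_j), R_{ε_j})`. -/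
theorem overlap_of_concentration_balls
    (N lam : ℝ) (hN : 0 < N)
    (ρ : ℕ → EuclideanSpace ℝ (Fin 3) → ℝ)
    (hint : ∀ k, Integrable (ρ k))
    (hpos : ∀ k x, 0 ≤ ρ k x)
    (hmass : ∀ k, (∫ x, ρ k x) = N)
    (hlam : lam ∈ Set.Ioc 0 N)
    (R : ℝ → ℝ) (y : ℝ → ℕ → EuclideanSpace ℝ (Fin 3))
    (hR : ∀ ε > (0:ℝ), 0 < R ε)
    (hconc : ∀ ε > (0:ℝ),
      lam - ε ≤ liminf (fun k => ∫ x in ball (y ε k) (R ε), ρ k x) atTop)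
    (m : ℕ) (hm : 0 < m) (hmlam : N < (m : ℝ) * lam) :
    ∃ φ : ℕ → ℕ, StrictMono φ ∧
      ∃ eps : Fin (m - 1) → ℝ, (∀ j, 0 < eps j) ∧
        ∃ δ > (0:ℝ), ∃ ε₀ > (0:ℝ), ∀ ε : ℝ, 0 < ε → ε < ε₀ →
          δ ≤ liminf
                (fun l => ∫ x in
                    (ball (y ε (φ l)) (R ε) ∩ ⋃ j : Fin (m - 1), ball (y (eps j) (φ l)) (R (eps j))),
                  ρ (φ l) x)
                atTop := by
  by_contra! hcon
  have hm' : (0 : ℝ) < m := by exact_mod_cast hm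
  set d : ℝ := (m * lam - N) / (6 * m) with hd_def
  have hd : 0 < d := div_pos (by linarith) (by linarith)
  obtain ⟨φ, -, e, -, hU⟩ := exists_subseq_mul_le_setIntegral_iUnion hint hpos hmass
    (d := d) (A := fun ε k => ball (y ε k) (R ε)) (fun _ _ => measurableSet_ball) hconc (p := m - 1)
    (fun φ hφ e he => by
      obtain ⟨ε, h₁, h₂, h₃⟩ := hcon φ hφ (fun j => e j) (fun j => he j) d hd d hd
      refine ⟨ε, h₁, h₂, ?_⟩
      have hunion (l : ℕ) : ⋃ j < m - 1, ball (y (e j) (φ l)) (R (e j))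
          = ⋃ j : Fin (m - 1), ball (y (e j) (φ l)) (R (e j)) := by
        ext x
        simp [Fin.exists_iff]
      simpa only [hunion] using h₃)
    m (by omega)
  have hle : m * (lam - 3 * d) ≤ N :=
    (hU 0).trans
      (hmass (φ 0) ▸ setIntegral_le_integral (hint _) (ae_of_all _ (hpos _)))
  have hd' : d * (6 * m) = m * lam - N := div_mul_cancel₀ _ (by positivity)
  linarith
end
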